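/- arXiv:1101.1612 — 5 statements merged into one kernel-verified Lean document; each statement's English description precedes it below -/
import Mathlib

section
/- Let φ, ψ : ℝⁿ → ℝ be smooth strictly convex functions such that |φ − ψ| is bounded on ℝⁿ, and suppose the gradient maps ∇φ and ∇ψ are diffeomorphisms from ℝⁿ onto the same bounded open set Δ ⊂ ℝⁿ. For s ∈ [0,1] let φ_s := (1−s)φ + sψ. Then ∫₀¹ ( ∫_{ℝⁿ} (ψ(x) − φ(x)) · det(∇²φ_s(x)) dx ) ds = ∫_Δ (φ*(y) − ψ*(y)) dy, where φ*(y) := sup_{x∈ℝⁿ}(⟨x,y⟩ − φ(x)) and ψ*(y) := sup_{x∈ℝⁿ}(⟨x,y⟩ − ψ(x)) denote the Legendre transforms (which are finite on Δ), and ∇²φ_s(x) denotes the Hessian matrix of φ_s at x. -/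
open scoped RealInnerProductSpace
open MeasureTheory

/-- The determinant of the Hessian matrix of `f` at `x`, computed as the determinant of the
matrix of the Fréchet derivative of the gradient map in the standard basis. -/
noncomputable def hessDet {n : ℕ} (f : EuclideanSpace ℝ (Fin n) → ℝ)
    (x : EuclideanSpace ℝ (Fin n)) : ℝ :=
  Matrix.det (Matrix.of fun i j : Fin n =>
    (fderiv ℝ (gradient f) x (EuclideanSpace.single j 1)) i)

/-- The Legendre transform of `f` at `y`: `sup_x (⟨x,y⟩ − f x)`. -/
noncomputable def legendreTransform {n : ℕ} (f : EuclideanSpace ℝ (Fin n) → ℝ)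
    (y : EuclideanSpace ℝ (Fin n)) : ℝ :=
  ⨆ x : EuclideanSpace ℝ (Fin n), (⟪x, y⟫ - f x)

open Filter Topology

section Convex

variable {E : Type*} [NormedAddCommGroup E] [InnerProductSpace ℝ E] [CompleteSpace E]

/-- A differentiable convex function lies above its tangent hyperplanes. -/
theorem ConvexOn.add_inner_gradient_le {f : E → ℝ} (hf : ConvexOn ℝ Set.univ f) {x : E}
    (hd : DifferentiableAt ℝ f x) (y : E) : f x + ⟪y - x, gradient f x⟫ ≤ f y := by
  have hline : ConvexOn ℝ Set.univ (fun t : ℝ => f (AffineMap.lineMap x y t)) := by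
    have h := hf.comp_affineMap (AffineMap.lineMap (k := ℝ) x y)
    rwa [Set.preimage_univ] at h
  have hder : HasDerivAt (fun t : ℝ => f (AffineMap.lineMap x y t))
      ⟪y - x, gradient f x⟫ 0 := by
    have h0 : HasFDerivAt f (InnerProductSpace.toDual ℝ E (gradient f x))
        (AffineMap.lineMap x y (0 : ℝ)) := by
      simpa using hd.hasFDerivAt
    have h := h0.comp_hasDerivAt (0 : ℝ) (AffineMap.hasDerivAt_lineMap (a := x) (b := y))
    rw [InnerProductSpace.toDual_apply_apply, real_inner_comm] at h
    exact h
  have h := hline.le_slope_of_hasDerivAt (Set.mem_univ 0) (Set.mem_univ 1) one_pos hder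
  rw [slope_def_field, AffineMap.lineMap_apply_one, AffineMap.lineMap_apply_zero, sub_zero,
    div_one] at h
  linarith

theorem StrictConvexOn.add_inner_gradient_lt {f : E → ℝ} (hf : StrictConvexOn ℝ Set.univ f)
    {x : E} (hd : DifferentiableAt ℝ f x) {y : E} (hne : x ≠ y) :
    f x + ⟪y - x, gradient f x⟫ < f y := by
  have hlt := hf.2 (Set.mem_univ x) (Set.mem_univ y) hne
    (by norm_num : (0 : ℝ) < 1 / 2) (by norm_num : (0 : ℝ) < 1 / 2) (by norm_num)
  have h1 := hf.convexOn.add_inner_gradient_le hd ((1 / 2 : ℝ) • x + (1 / 2 : ℝ) • y)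
  simp only [inner_sub_left, inner_add_left, real_inner_smul_left, smul_eq_mul] at h1 hlt ⊢
  linarith

theorem StrictConvexOn.gradient_injective {f : E → ℝ} (hf : StrictConvexOn ℝ Set.univ f)
    (hd : Differentiable ℝ f) : Function.Injective (gradient f) := by
  intro x y hxy
  by_contra hne
  have h1 := hf.add_inner_gradient_lt (hd x) hne
  have h2 := hf.add_inner_gradient_lt (hd y) (Ne.symm hne)
  rw [← hxy] at h2
  simp only [inner_sub_left] at h1 h2
  linarith

/-- Subtracting from a strictly convex function the linear function given by one of its gradients
makes it coercive. -/
theorem StrictConvexOn.tendsto_sub_inner_gradient [ProperSpace E] {f : E → ℝ}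
    (hf : StrictConvexOn ℝ Set.univ f) (hd : Differentiable ℝ f) (x : E) :
    Tendsto (fun y => f y - ⟪y, gradient f x⟫) (cocompact E) atTop := by
  obtain ⟨c, hc, hcs⟩ : ∃ c > 0, ∀ y ∈ Metric.sphere x 1,
      c ≤ f y - f x - ⟪y - x, gradient f x⟫ := by
    rcases (Metric.sphere x 1).eq_empty_or_nonempty with h | h
    · exact ⟨1, one_pos, by simp [h]⟩
    · obtain ⟨z, hz, hmin⟩ := (isCompact_sphere x 1).exists_isMinOn h
        (f := fun y => f y - f x - ⟪y - x, gradient f x⟫)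
        (by have := hd.continuous; fun_prop)
      refine ⟨_, ?_, fun y hy => hmin hy⟩
      have hne : x ≠ z := by
        rintro rfl
        simp at hz
      have := hf.add_inner_gradient_lt (hd x) hne
      dsimp only
      linarith
  have hgrow : ∀ y, 1 ≤ dist y x →
      c * dist y x + (f x - ⟪x, gradient f x⟫) ≤ f y - ⟪y, gradient f x⟫ := by
    intro y hy
    set r := dist y x with hr
    have hr0 : 0 < r := by linarith
    have hmem : (1 - r⁻¹) • x + r⁻¹ • y ∈ Metric.sphere x 1 := by
      have : (1 - r⁻¹) • x + r⁻¹ • y - x = r⁻¹ • (y - x) := by module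
      rw [mem_sphere_iff_norm, this, norm_smul, ← dist_eq_norm, ← hr, norm_inv,
        Real.norm_of_nonneg hr0.le, inv_mul_cancel₀ hr0.ne']
    have h1 := hcs _ hmem
    have h2 := hf.convexOn.2 (Set.mem_univ x) (Set.mem_univ y)
      (sub_nonneg.2 (inv_le_one_of_one_le₀ hy)) (inv_pos.2 hr0).le (by ring)
    simp only [inner_sub_left, inner_add_left, real_inner_smul_left, smul_eq_mul] at h1 h2
    have h3 : c ≤ r⁻¹ * (f y - f x - (⟪y, gradient f x⟫ - ⟪x, gradient f x⟫)) := by linarith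
    rw [inv_mul_eq_div, le_div_iff₀ hr0] at h3
    linarith
  have hdist := tendsto_dist_right_cocompact_atTop x
  refine tendsto_atTop_mono' _ ?_ (tendsto_atTop_add_const_right _
    (f x - ⟪x, gradient f x⟫) (hdist.const_mul_atTop hc))
  filter_upwards [hdist.eventually_ge_atTop 1] with y hy using hgrow y hy

/-- A value `a` such that `f - ⟪·, a⟫` is coercive is attained by the gradient of `f`. -/
theorem exists_gradient_eq_of_tendsto {f : E → ℝ} (hd : Differentiable ℝ f) {a : E}
    (h : Tendsto (fun y => f y - ⟪y, a⟫) (cocompact E) atTop) : ∃ x, gradient f x = a := by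
  have hcont : Continuous fun y => f y - ⟪y, a⟫ := by have := hd.continuous; fun_prop
  obtain ⟨x, hx⟩ := hcont.exists_forall_le' 0 (h.eventually_ge_atTop _)
  refine ⟨x, HasGradientAt.gradient ?_⟩
  have hmin : IsLocalMin (fun y => f y - ⟪y, a⟫) x := Eventually.of_forall hx
  have hinner : HasFDerivAt (fun y : E => ⟪y, a⟫) (InnerProductSpace.toDual ℝ E a) x := by
    have := (InnerProductSpace.toDual ℝ E a).hasFDerivAt (x := x)
    refine this.congr_of_eventuallyEq (Eventually.of_forall fun y => ?_)
    simp [real_inner_comm]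
  have hz := hmin.hasFDerivAt_eq_zero ((hd x).hasFDerivAt.sub hinner)
  rw [hasGradientAt_iff_hasFDerivAt, ← sub_eq_zero.1 hz]
  exact (hd x).hasFDerivAt

end Convex

/-- A function with a subgradient `D s` at every point `s ∈ [0, 1]` is an antiderivative of `D`. -/
theorem integral_Icc_eq_sub_of_subgradient {F D : ℝ → ℝ}
    (h : ∀ s ∈ Set.Icc (0 : ℝ) 1, ∀ t ∈ Set.Icc (0 : ℝ) 1, (t - s) * D s ≤ F t - F s) :
    ∫ s in Set.Icc (0 : ℝ) 1, D s = F 1 - F 0 := by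
  have hmono : MonotoneOn D (Set.Icc 0 1) := by
    intro s hs t ht hst
    rcases hst.eq_or_lt with rfl | hlt
    · rfl
    have h1 := h s hs t ht
    have h2 := h t ht s hs
    exact le_of_mul_le_mul_left (by linarith : (t - s) * D s ≤ (t - s) * D t) (sub_pos.2 hlt)
  have hsub : ∀ a ∈ Set.Icc (0 : ℝ) 1, ∀ b ∈ Set.Icc (0 : ℝ) 1, a ≤ b →
      IntervalIntegrable D volume a b ∧
        |F b - F a - ∫ s in a..b, D s| ≤ (b - a) * (D b - D a) := by
    intro a ha b hb hab
    have hm : MonotoneOn D (Set.Icc a b) := hmono.mono (Set.Icc_subset_Icc ha.1 hb.2)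
    have hi : IntervalIntegrable D volume a b :=
      MonotoneOn.intervalIntegrable (by rwa [Set.uIcc_of_le hab])
    have hlow : (b - a) * D a ≤ ∫ s in a..b, D s := by
      have := intervalIntegral.integral_mono_on hab intervalIntegrable_const hi
        fun s hs => hm (Set.left_mem_Icc.2 hab) hs hs.1
      simpa using this
    have hup : ∫ s in a..b, D s ≤ (b - a) * D b := by
      have := intervalIntegral.integral_mono_on hab hi intervalIntegrable_const
        fun s hs => hm hs (Set.right_mem_Icc.2 hab) hs.2
      simpa using this
    have h1 := h a ha b hb
    have h2 := h b hb a ha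
    exact ⟨hi, abs_le.2 ⟨by linarith, by linarith⟩⟩
  have hbound : ∀ N : ℕ, |F 1 - F 0 - ∫ s in (0 : ℝ)..1, D s| ≤
      1 / ((N : ℝ) + 1) * (D 1 - D 0) := by
    intro N
    have hN : (0 : ℝ) < N + 1 := by positivity
    let e : ℕ → ℝ := fun i => i / ((N : ℝ) + 1)
    have hmem : ∀ i ≤ N + 1, e i ∈ Set.Icc (0 : ℝ) 1 := fun i hi =>
      ⟨by positivity, (div_le_one hN).2 (by exact_mod_cast hi)⟩
    have hstep : ∀ i, e (i + 1) - e i = 1 / ((N : ℝ) + 1) := fun i => by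
      simp only [e]; push_cast; ring
    have hle : ∀ i, e i ≤ e (i + 1) := fun i => by
      have := hstep i
      have : (0 : ℝ) < 1 / ((N : ℝ) + 1) := by positivity
      linarith
    have he0 : e 0 = 0 := by simp [e]
    have he1 : e (N + 1) = 1 := by simp only [e]; push_cast; exact div_self hN.ne'
    have hpiece : ∀ i < N + 1, _ := fun i hi =>
      hsub (e i) (hmem i hi.le) (e (i + 1)) (hmem (i + 1) hi) (hle i)
    have hint := intervalIntegral.sum_integral_adjacent_intervals (μ := volume) (f := D)
      (a := e) (n := N + 1) fun i hi => (hpiece i hi).1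
    have hF := Finset.sum_range_sub (fun i => F (e i)) (N + 1)
    have hD := Finset.sum_range_sub (fun i => D (e i)) (N + 1)
    rw [he0, he1] at hint
    simp only [he0, he1] at hF hD
    rw [← hF, ← hD, ← hint, ← Finset.sum_sub_distrib, Finset.mul_sum]
    refine (Finset.abs_sum_le_sum_abs _ _).trans (Finset.sum_le_sum fun i hi => ?_)
    rw [← hstep i]
    exact (hpiece i (Finset.mem_range.1 hi)).2
  have hlim : Tendsto (fun N : ℕ => 1 / ((N : ℝ) + 1) * (D 1 - D 0)) atTop (𝓝 0) := by
    simpa using tendsto_one_div_add_atTop_nhds_zero_nat.mul_const (D 1 - D 0)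
  have hzero := abs_nonpos_iff.1 (ge_of_tendsto' hlim hbound)
  rw [integral_Icc_eq_integral_Ioc, ← intervalIntegral.integral_of_le zero_le_one]
  linarith

section Hessian

variable {n : ℕ}

theorem ContDiff.gradient_euclidean {f : EuclideanSpace ℝ (Fin n) → ℝ} {k m : WithTop ℕ∞}
    (hf : ContDiff ℝ k f) (hmk : m + 1 ≤ k) : ContDiff ℝ m (gradient f) := by
  rw [contDiff_euclidean]
  intro i
  have h : (fun x => gradient f x i) = fun x => fderiv ℝ f x (EuclideanSpace.single i 1) := by
    funext x
    rw [← toDual_gradient, InnerProductSpace.toDual_apply_apply,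
      EuclideanSpace.inner_single_right]
    simp
  rw [h]
  exact (hf.fderiv_right hmk).clm_apply contDiff_const

theorem inner_fderiv_gradient {f : EuclideanSpace ℝ (Fin n) → ℝ} (hf : ContDiff ℝ 2 f)
    (x v w : EuclideanSpace ℝ (Fin n)) :
    ⟪fderiv ℝ (gradient f) x v, w⟫ = fderiv ℝ (fderiv ℝ f) x v w := by
  have hg : HasFDerivAt (gradient f) (fderiv ℝ (gradient f) x) x :=
    ((hf.gradient_euclidean (m := 1) (by norm_num)).differentiable one_ne_zero x).hasFDerivAt
  have hf' : HasFDerivAt (fderiv ℝ f) (fderiv ℝ (fderiv ℝ f) x) x :=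
    ((hf.fderiv_right (m := 1) (by norm_num)).differentiable one_ne_zero x).hasFDerivAt
  have h1 := hg.inner ℝ (hasFDerivAt_const w x)
  have h2 := hf'.clm_apply (hasFDerivAt_const w x)
  have heq : (fun z => ⟪gradient f z, w⟫) = fun z => fderiv ℝ f z w := by
    funext z
    rw [← toDual_gradient, InnerProductSpace.toDual_apply_apply]
  rw [heq] at h1
  simpa using DFunLike.congr_fun (h1.unique h2) v

theorem hessDet_eq_det_fderiv (f : EuclideanSpace ℝ (Fin n) → ℝ) (x : EuclideanSpace ℝ (Fin n)) :
    hessDet f x = (fderiv ℝ (gradient f) x).det := by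
  rw [ContinuousLinearMap.det, ← LinearMap.det_toMatrix (EuclideanSpace.basisFun (Fin n) ℝ).toBasis]
  congr 1

theorem hessDet_nonneg {f : EuclideanSpace ℝ (Fin n) → ℝ} (hf : ContDiff ℝ 2 f)
    (hconv : ConvexOn ℝ Set.univ f) (x : EuclideanSpace ℝ (Fin n)) : 0 ≤ hessDet f x := by
  have hd : Differentiable ℝ f := hf.differentiable two_ne_zero
  have hg : HasFDerivAt (gradient f) (fderiv ℝ (gradient f) x) x :=
    ((hf.gradient_euclidean (m := 1) (by norm_num)).differentiable one_ne_zero x).hasFDerivAt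
  have hpos : ((fderiv ℝ (gradient f) x : _ →L[ℝ] _) :
      EuclideanSpace ℝ (Fin n) →ₗ[ℝ] EuclideanSpace ℝ (Fin n)).IsPositive := by
    refine ⟨fun v w => ?_, fun v => ?_⟩
    · simp only [ContinuousLinearMap.coe_coe]
      rw [real_inner_comm _ v, inner_fderiv_gradient hf, inner_fderiv_gradient hf]
      exact hf.contDiffAt.isSymmSndFDerivAt (by simp) v w
    · simp only [ContinuousLinearMap.coe_coe, RCLike.re_to_real]
      have hline : HasDerivAt (fun t : ℝ => ⟪gradient f (x + t • v), v⟫)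
          ⟪fderiv ℝ (gradient f) x v, v⟫ 0 := by
        have h0 : HasDerivAt (fun t : ℝ => x + t • v) v 0 := by
          simpa using ((hasDerivAt_id (0 : ℝ)).smul_const v).const_add x
        have hg' : HasFDerivAt (gradient f) (fderiv ℝ (gradient f) x) (x + (0 : ℝ) • v) := by
          simpa using hg
        simpa using (hg'.comp_hasDerivAt (0 : ℝ) h0).inner ℝ (hasDerivAt_const (0 : ℝ) v)
      have hmono : Monotone fun t : ℝ => ⟪gradient f (x + t • v), v⟫ := by
        intro s t hst
        rcases hst.eq_or_lt with rfl | hlt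
        · rfl
        have h1 := hconv.add_inner_gradient_le (hd (x + s • v)) (x + t • v)
        have h2 := hconv.add_inner_gradient_le (hd (x + t • v)) (x + s • v)
        have e1 : x + t • v - (x + s • v) = (t - s) • v := by module
        have e2 : x + s • v - (x + t • v) = (s - t) • v := by module
        rw [e1, real_inner_smul_left, real_inner_comm] at h1
        rw [e2, real_inner_smul_left, real_inner_comm] at h2
        refine le_of_mul_le_mul_left ?_ (sub_pos.2 hlt)
        linarith
      rw [← hline.deriv]
      exact hmono.deriv_nonneg
  have h := ((LinearMap.posSemidef_toMatrix_iff
    (EuclideanSpace.basisFun (Fin n) ℝ)).2 hpos).det_nonneg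
  rwa [LinearMap.det_toMatrix, ← ContinuousLinearMap.det, ← hessDet_eq_det_fderiv] at h

/-- Change of variables along the gradient map of a strictly convex function. -/
theorem integral_comp_mul_hessDet {f : EuclideanSpace ℝ (Fin n) → ℝ} (hf : ContDiff ℝ 2 f)
    (hconv : StrictConvexOn ℝ Set.univ f) {Δ : Set (EuclideanSpace ℝ (Fin n))}
    (hrange : Set.range (gradient f) = Δ) (hΔ : volume Δ ≠ ⊤)
    {w : EuclideanSpace ℝ (Fin n) → ℝ} (hw : Continuous w) {B : ℝ} (hB : ∀ x, |w x| ≤ B)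
    {X : EuclideanSpace ℝ (Fin n) → EuclideanSpace ℝ (Fin n)}
    (hX : ∀ x, X (gradient f x) = x) :
    IntegrableOn (fun y => w (X y)) Δ ∧
      ∫ y in Δ, w (X y) = ∫ x, w x * hessDet f x := by
  have hd : Differentiable ℝ f := hf.differentiable two_ne_zero
  have hg : ∀ x ∈ Set.univ, HasFDerivWithinAt (gradient f) (fderiv ℝ (gradient f) x)
      Set.univ x := fun x _ => ((hf.gradient_euclidean (m := 1)
    (by norm_num)).differentiable one_ne_zero x).hasFDerivAt.hasFDerivWithinAt
  have hinj : Set.InjOn (gradient f) Set.univ := (hconv.gradient_injective hd).injOn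
  have habs : ∀ x, |(fderiv ℝ (gradient f) x).det| = hessDet f x := fun x => by
    rw [← hessDet_eq_det_fderiv, abs_of_nonneg (hessDet_nonneg hf hconv.convexOn x)]
  rw [← Set.image_univ] at hrange
  have hone : IntegrableOn (fun _ => (1 : ℝ)) Δ := integrableOn_const hΔ
  rw [← hrange] at hone ⊢
  rw [integrableOn_image_iff_integrableOn_abs_det_fderiv_smul volume MeasurableSet.univ hg hinj,
    integrableOn_univ] at hone ⊢
  rw [integral_image_eq_integral_abs_det_fderiv_smul volume MeasurableSet.univ hg hinj,
    setIntegral_univ]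
  simp only [habs, hX, smul_eq_mul, mul_one] at hone ⊢
  refine ⟨?_, by simp only [mul_comm]⟩
  exact hone.mul_bdd hw.aestronglyMeasurable (Eventually.of_forall hB)

end Hessian

section Legendre

variable {n : ℕ} {f : EuclideanSpace ℝ (Fin n) → ℝ}

theorem ConvexOn.isGreatest_inner_sub (hf : ConvexOn ℝ Set.univ f)
    {x : EuclideanSpace ℝ (Fin n)} (hd : DifferentiableAt ℝ f x) :
    IsGreatest (Set.range fun z => ⟪z, gradient f x⟫ - f z) (⟪x, gradient f x⟫ - f x) := by
  refine ⟨⟨x, rfl⟩, ?_⟩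
  rintro _ ⟨z, rfl⟩
  have := hf.add_inner_gradient_le hd z
  rw [inner_sub_left] at this
  dsimp only
  linarith

theorem ConvexOn.legendreTransform_gradient (hf : ConvexOn ℝ Set.univ f)
    {x : EuclideanSpace ℝ (Fin n)} (hd : DifferentiableAt ℝ f x) :
    legendreTransform f (gradient f x) = ⟪x, gradient f x⟫ - f x :=
  (hf.isGreatest_inner_sub hd).csSup_eq

theorem ConvexOn.inner_sub_le_legendreTransform (hf : ConvexOn ℝ Set.univ f)
    (hd : Differentiable ℝ f) {y : EuclideanSpace ℝ (Fin n)} (hy : y ∈ Set.range (gradient f))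
    (z : EuclideanSpace ℝ (Fin n)) : ⟪z, y⟫ - f z ≤ legendreTransform f y := by
  obtain ⟨x, rfl⟩ := hy
  rw [hf.legendreTransform_gradient (hd x)]
  exact (hf.isGreatest_inner_sub (hd x)).2 ⟨z, rfl⟩

theorem ConvexOn.legendreTransform_convexOn (hf : ConvexOn ℝ Set.univ f)
    (hd : Differentiable ℝ f) (hconv : Convex ℝ (Set.range (gradient f))) :
    ConvexOn ℝ (Set.range (gradient f)) (legendreTransform f) := by
  refine ⟨hconv, fun y hy z hz a b ha hb hab => ciSup_le fun x => ?_⟩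
  have h1 := mul_le_mul_of_nonneg_left (hf.inner_sub_le_legendreTransform hd hy x) ha
  have h2 := mul_le_mul_of_nonneg_left (hf.inner_sub_le_legendreTransform hd hz x) hb
  have h3 : f x = a * f x + b * f x := by rw [← add_mul, hab, one_mul]
  rw [inner_add_right, real_inner_smul_right, real_inner_smul_right, smul_eq_mul, smul_eq_mul]
  linarith

/-- The Legendre transforms of functions at bounded distance are at bounded distance. -/
theorem legendreTransform_le_add {g : EuclideanSpace ℝ (Fin n) → ℝ}
    (hg : ConvexOn ℝ Set.univ g) (hd : Differentiable ℝ g) {B : ℝ} (hB : ∀ x, g x ≤ f x + B)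
    {y : EuclideanSpace ℝ (Fin n)} (hy : y ∈ Set.range (gradient g)) :
    legendreTransform f y ≤ legendreTransform g y + B :=
  ciSup_le fun x => by
    have := hg.inner_sub_le_legendreTransform hd hy x
    linarith [hB x]

end Legendre

/-- The set of gradients of a strictly convex function is convex. -/
theorem StrictConvexOn.convex_range_gradient {E : Type*} [NormedAddCommGroup E]
    [InnerProductSpace ℝ E] [CompleteSpace E] [ProperSpace E] {f : E → ℝ}
    (hf : StrictConvexOn ℝ Set.univ f) (hd : Differentiable ℝ f) :
    Convex ℝ (Set.range (gradient f)) := by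
  rw [convex_iff_forall_pos]
  rintro _ ⟨x, rfl⟩ _ ⟨z, rfl⟩ a b ha hb hab
  refine exists_gradient_eq_of_tendsto hd ?_
  refine (((hf.tendsto_sub_inner_gradient hd x).const_mul_atTop ha).atTop_add_atTop
    ((hf.tendsto_sub_inner_gradient hd z).const_mul_atTop hb)).congr fun y => ?_
  rw [inner_add_right, real_inner_smul_right, real_inner_smul_right]
  linear_combination (f y) * hab

theorem gradient_convexCombination {E : Type*} [NormedAddCommGroup E]
    [InnerProductSpace ℝ E] [CompleteSpace E] {f g : E → ℝ} (hf : Differentiable ℝ f)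
    (hg : Differentiable ℝ g) (a b : ℝ) (x : E) :
    gradient (fun z => a * f z + b * g z) x = a • gradient f x + b • gradient g x := by
  have h : fderiv ℝ (fun z => a * f z + b * g z) x = a • fderiv ℝ f x + b • fderiv ℝ g x :=
    (((hf x).hasFDerivAt.const_mul a).add ((hg x).hasFDerivAt.const_mul b)).fderiv
  simp [gradient, h]

theorem StrictConvexOn.convexCombination {E : Type*} [AddCommGroup E] [Module ℝ E]
    {S : Set E} {f g : E → ℝ} (hf : StrictConvexOn ℝ S f) (hg : StrictConvexOn ℝ S g) {s : ℝ}
    (hs : s ∈ Set.Icc (0 : ℝ) 1) : StrictConvexOn ℝ S fun z => (1 - s) * f z + s * g z := by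
  refine ⟨hf.1, fun x hx y hy hne a b ha hb hab => ?_⟩
  have h1 := hf.2 hx hy hne ha hb hab
  have h2 := hg.2 hx hy hne ha hb hab
  simp only [smul_eq_mul] at h1 h2 ⊢
  rcases hs.1.eq_or_lt with rfl | hs0
  · simpa using h1
  · have h3 := mul_le_mul_of_nonneg_left h1.le (sub_nonneg.2 hs.2)
    have h4 := mul_lt_mul_of_pos_left h2 hs0
    linarith

/-- The gradients of convex combinations of two strictly convex functions at bounded distance
with the same set of gradients fill that same set. -/
theorem range_gradient_convexCombination {E : Type*} [NormedAddCommGroup E]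
    [InnerProductSpace ℝ E] [CompleteSpace E] [ProperSpace E] {f g : E → ℝ}
    (hf : StrictConvexOn ℝ Set.univ f) (hfd : Differentiable ℝ f) (hgd : Differentiable ℝ g)
    {B : ℝ} (hB : ∀ x, |f x - g x| ≤ B) (hfg : Set.range (gradient g) = Set.range (gradient f))
    {s : ℝ} (hs : s ∈ Set.Icc (0 : ℝ) 1) :
    Set.range (gradient fun z => (1 - s) * f z + s * g z) = Set.range (gradient f) := by
  refine Set.Subset.antisymm ?_ ?_
  · rintro _ ⟨x, rfl⟩
    rw [gradient_convexCombination hfd hgd]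
    exact hf.convex_range_gradient hfd ⟨x, rfl⟩ (hfg ▸ ⟨x, rfl⟩) (sub_nonneg.2 hs.2) hs.1
      (by ring)
  · rintro _ ⟨x, rfl⟩
    refine exists_gradient_eq_of_tendsto (by fun_prop) ?_
    refine tendsto_atTop_mono (fun y => ?_) (tendsto_atTop_add_const_right _ (-B)
      (hf.tendsto_sub_inner_gradient hfd x))
    have h1 := (abs_le.1 (hB y)).2
    have h2 := mul_le_mul_of_nonneg_left h1 hs.1
    have h3 := mul_le_mul_of_nonneg_right hs.2 ((abs_nonneg _).trans (hB y))
    linarith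

/-- For smooth strictly convex φ, ψ with |φ − ψ| bounded and gradient maps that
are diffeomorphisms onto the same bounded open set Δ, the energy
∫₀¹ ∫ (ψ − φ) det(∇²φ_s) dx ds equals ∫_Δ (φ* − ψ*) dy where φ_s = (1−s)φ + sψ. -/
theorem energy_eq_integral_of_legendre_transforms {n : ℕ}
    (φ ψ : EuclideanSpace ℝ (Fin n) → ℝ)
    (hφ : ContDiff ℝ (⊤ : ℕ∞) φ) (hψ : ContDiff ℝ (⊤ : ℕ∞) ψ)
    (hφconv : StrictConvexOn ℝ Set.univ φ) (hψconv : StrictConvexOn ℝ Set.univ ψ)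
    (hbdd : ∃ B : ℝ, ∀ x, |φ x - ψ x| ≤ B)
    (Δ : Set (EuclideanSpace ℝ (Fin n)))
    (hΔopen : IsOpen Δ) (hΔbdd : Bornology.IsBounded Δ)
    -- the gradient of φ is a diffeomorphism from ℝⁿ onto Δ:
    (gφ : EuclideanSpace ℝ (Fin n) → EuclideanSpace ℝ (Fin n))
    (hφbij : Set.BijOn (gradient φ) Set.univ Δ)
    (hgφ : ContDiffOn ℝ (⊤ : ℕ∞) gφ Δ)
    (hgφleft : ∀ x, gφ (gradient φ x) = x)
    (hgφright : ∀ y ∈ Δ, gradient φ (gφ y) = y)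
    -- the gradient of ψ is a diffeomorphism from ℝⁿ onto Δ:
    (gψ : EuclideanSpace ℝ (Fin n) → EuclideanSpace ℝ (Fin n))
    (hψbij : Set.BijOn (gradient ψ) Set.univ Δ)
    (hgψ : ContDiffOn ℝ (⊤ : ℕ∞) gψ Δ)
    (hgψleft : ∀ x, gψ (gradient ψ x) = x)
    (hgψright : ∀ y ∈ Δ, gradient ψ (gψ y) = y) :
    ∫ s in Set.Icc (0:ℝ) 1,
        (∫ x, (ψ x - φ x) * hessDet (fun z => (1 - s) * φ z + s * ψ z) x)
      = ∫ y in Δ, (legendreTransform φ y - legendreTransform ψ y) := by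
  obtain ⟨B, hB⟩ := hbdd
  have hφd : Differentiable ℝ φ := hφ.differentiable (by simp)
  have hψd : Differentiable ℝ ψ := hψ.differentiable (by simp)
  have hφr : Set.range (gradient φ) = Δ := by rw [← Set.image_univ, hφbij.image_eq]
  have hψr : Set.range (gradient ψ) = Δ := by rw [← Set.image_univ, hψbij.image_eq]
  set u : ℝ → EuclideanSpace ℝ (Fin n) → ℝ := fun s z => (1 - s) * φ z + s * ψ z with hu
  have hu0 : u 0 = φ := by simp [hu]
  have hu1 : u 1 = ψ := by simp [hu]
  have htwo : (2 : WithTop ℕ∞) ≤ ((⊤ : ℕ∞) : WithTop ℕ∞) := WithTop.coe_le_coe.2 le_top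
  have huC : ∀ s, ContDiff ℝ 2 (u s) := fun s =>
    ((contDiff_const.mul hφ).add (contDiff_const.mul hψ)).of_le htwo
  have hud : ∀ s, Differentiable ℝ (u s) := fun s => (huC s).differentiable two_ne_zero
  have hus : ∀ s ∈ Set.Icc (0 : ℝ) 1, StrictConvexOn ℝ Set.univ (u s) := fun s hs =>
    hφconv.convexCombination hψconv hs
  have hur : ∀ s ∈ Set.Icc (0 : ℝ) 1, Set.range (gradient (u s)) = Δ := fun s hs =>
    (range_gradient_convexCombination hφconv hφd hψd hB (hψr.trans hφr.symm) hs).trans hφr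
  have hvol : volume Δ ≠ ⊤ := hΔbdd.measure_lt_top.ne
  have hLcont : ∀ s ∈ Set.Icc (0 : ℝ) 1, ContinuousOn (legendreTransform (u s)) Δ := by
    intro s hs
    rw [← hur s hs] at hΔopen ⊢
    exact ((hus s hs).convexOn.legendreTransform_convexOn (hud s)
      ((hus s hs).convex_range_gradient (hud s))).continuousOn hΔopen
  have hdist : ∀ s ∈ Set.Icc (0 : ℝ) 1, ∀ x, |u s x - φ x| ≤ B := by
    intro s hs x
    have h : u s x - φ x = s * (ψ x - φ x) := by simp only [hu]; ring
    rw [h, abs_mul, abs_of_nonneg hs.1, abs_sub_comm]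
    exact (mul_le_of_le_one_left (abs_nonneg _) hs.2).trans (hB x)
  have hLint : ∀ s ∈ Set.Icc (0 : ℝ) 1,
      IntegrableOn (fun y => legendreTransform (u s) y - legendreTransform φ y) Δ := by
    intro s hs
    have hLφ := hLcont 0 (by simp)
    rw [hu0] at hLφ
    refine ⟨((hLcont s hs).sub hLφ).aestronglyMeasurable hΔopen.measurableSet,
      .restrict_of_bounded (C := B) hvol.lt_top ?_⟩
    refine ae_restrict_of_forall_mem hΔopen.measurableSet fun y hy => abs_le.2 ⟨?_, ?_⟩
    · have := legendreTransform_le_add (f := φ) (hus s hs).convexOn (hud s)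
        (fun x => by linarith [(abs_le.1 (hdist s hs x)).2] : ∀ x, u s x ≤ φ x + B)
        (by rwa [hur s hs])
      linarith
    · have := legendreTransform_le_add (f := u s) hφconv.convexOn hφd
        (fun x => by linarith [(abs_le.1 (hdist s hs x)).1] : ∀ x, φ x ≤ u s x + B)
        (by rwa [hφr])
      linarith
  let F : ℝ → ℝ := fun s => ∫ y in Δ, (legendreTransform (u s) y - legendreTransform φ y)
  let D : ℝ → ℝ := fun s => -∫ x, (ψ x - φ x) * hessDet (u s) x
  have hsub : ∀ s ∈ Set.Icc (0 : ℝ) 1, ∀ t ∈ Set.Icc (0 : ℝ) 1, (t - s) * D s ≤ F t - F s := by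
    intro s hs t ht
    set X := Function.invFun (gradient (u s))
    have hXl : ∀ x, X (gradient (u s) x) = x :=
      Function.leftInverse_invFun ((hus s hs).gradient_injective (hud s))
    obtain ⟨hint, heq⟩ := integral_comp_mul_hessDet (w := fun x => ψ x - φ x) (huC s) (hus s hs) (hur s hs) hvol
      (hψd.continuous.sub hφd.continuous)
      (fun x => (abs_sub_comm _ _).trans_le (hB x)) hXl
    have hD : (t - s) * D s = ∫ y in Δ, -(t - s) * (ψ (X y) - φ (X y)) := by
      rw [integral_const_mul, heq]
      ring
    rw [hD, ← integral_sub (hLint t ht) (hLint s hs)]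
    refine setIntegral_mono_on (hint.const_mul _) ((hLint t ht).sub (hLint s hs))
      hΔopen.measurableSet fun y hy => ?_
    have h1 := (hus t ht).convexOn.inner_sub_le_legendreTransform (hud t)
      (by rwa [hur t ht] : y ∈ Set.range (gradient (u t))) (X y)
    rw [← hur s hs] at hy
    obtain ⟨x, rfl⟩ := hy
    rw [hXl] at h1 ⊢
    rw [(hus s hs).convexOn.legendreTransform_gradient (hud s x)]
    simp only [hu] at h1 ⊢
    linarith
  have hmain := integral_Icc_eq_sub_of_subgradient hsub
  simp only [F, D, hu0, hu1, integral_neg, sub_self, integral_zero, sub_zero] at hmain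
  rw [neg_eq_iff_eq_neg, ← integral_neg] at hmain
  simpa only [neg_sub] using hmain
end

section
/- Let φ : ℝⁿ → ℝ be a smooth strictly convex function whose gradient map ∇φ is a diffeomorphism from ℝⁿ onto the open convex set Δ_φ of subgradients of φ, and let u : Δ_φ → ℝ be a bounded continuous concave function. For λ ∈ ℝ set A_λ := {y ∈ Δ_φ : u(y) ≥ λ} and φ_λ(x) := sup{ψ(x) : ψ : ℝⁿ → ℝ convex, ψ ≤ φ on ℝⁿ, and Δ_ψ ⊆ A_λ}. Then for all λ₁, λ₂ ∈ ℝ with A_{λ₁} and A_{λ₂} nonempty, all s ∈ [0,1], and all x ∈ ℝⁿ: φ_{sλ₁+(1−s)λ₂}(x) ≥ s·φ_{λ₁}(x) + (1−s)·φ_{λ₂}(x); that is, the curve λ ↦ φ_λ is concave in λ. -/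
open scoped RealInnerProductSpace

/-- The set of subgradients of a function `ψ : ℝⁿ → ℝ`: those `y` such that
`x ↦ ψ(x) − ⟨x,y⟩` is bounded below. -/
def subgradSet {n : ℕ} (ψ : EuclideanSpace ℝ (Fin n) → ℝ) : Set (EuclideanSpace ℝ (Fin n)) :=
  {y | BddBelow (Set.range fun x => ψ x - ⟪x, y⟫)}

/-- The envelope `sup {ψ(x) : ψ convex, ψ ≤ φ, Δ_ψ ⊆ A}`. -/
noncomputable def envlp {n : ℕ} (φ : EuclideanSpace ℝ (Fin n) → ℝ)
    (A : Set (EuclideanSpace ℝ (Fin n))) (x : EuclideanSpace ℝ (Fin n)) : ℝ :=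
  sSup {v : ℝ | ∃ ψ : EuclideanSpace ℝ (Fin n) → ℝ,
    ConvexOn ℝ Set.univ ψ ∧ (∀ z, ψ z ≤ φ z) ∧ subgradSet ψ ⊆ A ∧ v = ψ x}

/-- A concave function lying below a convex function on `ℝⁿ` is separated from it by an
affine function. -/
theorem ConvexOn.exists_affine_between {n : ℕ} {f h : EuclideanSpace ℝ (Fin n) → ℝ}
    (hf : ConvexOn ℝ Set.univ f) (hh : ConcaveOn ℝ Set.univ h) (hle : ∀ x, h x ≤ f x) :
    ∃ (a : EuclideanSpace ℝ (Fin n)) (c : ℝ), ∀ x, h x ≤ ⟪x, a⟫ + c ∧ ⟪x, a⟫ + c ≤ f x := by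
  have hcont : Continuous f := hf.locallyLipschitz.continuous
  have hopen : IsOpen {p : EuclideanSpace ℝ (Fin n) × ℝ | p.1 ∈ Set.univ ∧ f p.1 < p.2} := by
    simpa using isOpen_lt (hcont.comp continuous_fst) continuous_snd
  obtain ⟨F, u, hF₁, hF₂⟩ := geometric_hahn_banach_open hf.convex_strict_epigraph hopen
    hh.convex_hypograph (Set.disjoint_left.2 fun p hp hq =>
      absurd (hp.2.trans_le (hq.2.trans (hle p.1))) (lt_irrefl _))
  set L : StrongDual ℝ (EuclideanSpace ℝ (Fin n)) := F.comp (ContinuousLinearMap.inl ℝ _ ℝ) with hL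
  set β : ℝ := F (0, 1) with hβ
  have hFeq : ∀ x r, F (x, r) = L x + r * β := by
    intro x r
    have : ((x, r) : EuclideanSpace ℝ (Fin n) × ℝ) = (x, 0) + r • (0, 1) := by simp
    rw [this, map_add, map_smul]
    simp [hL, hβ]
  have hup : ∀ x r, f x < r → L x + r * β < u := fun x r hr => by
    rw [← hFeq]; exact hF₁ _ ⟨trivial, hr⟩
  have hlow : ∀ x, u ≤ L x + h x * β := fun x => by
    rw [← hFeq]; exact hF₂ _ ⟨trivial, le_rfl⟩
  have hβneg : β < 0 := by
    have h1 := hup 0 (f 0 + 1) (by linarith)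
    have h2 := hlow 0
    have h3 := hle 0
    by_contra! hb
    nlinarith
  have hup' : ∀ x, L x + f x * β ≤ u := by
    intro x
    refine le_of_forall_pos_le_add fun ε hε => ?_
    have h1 := hup x (f x + ε / (-β))
      (lt_add_of_pos_right _ (div_pos hε (neg_pos.2 hβneg)))
    have h2 : ε / (-β) * β = -ε := by
      rw [div_neg, neg_mul, div_mul_cancel₀ _ hβneg.ne]
    nlinarith
  refine ⟨(InnerProductSpace.toDual ℝ _).symm ((-β⁻¹) • L), u / β, fun x => ?_⟩
  have ha : ⟪x, (InnerProductSpace.toDual ℝ _).symm ((-β⁻¹) • L)⟫ + u / β = (u - L x) / β := by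
    rw [real_inner_comm, InnerProductSpace.toDual_symm_apply]
    simp
    ring
  rw [ha]
  exact ⟨(le_div_iff_of_neg hβneg).2 (by linarith [hlow x]),
    (div_le_iff_of_neg hβneg).2 (by linarith [hup' x])⟩

theorem exists_add_eq_of_mem_subgradSet_add {n : ℕ} {f g : EuclideanSpace ℝ (Fin n) → ℝ}
    (hf : ConvexOn ℝ Set.univ f) (hg : ConvexOn ℝ Set.univ g) {y : EuclideanSpace ℝ (Fin n)}
    (hy : y ∈ subgradSet (fun x => f x + g x)) :
    ∃ a ∈ subgradSet f, ∃ b ∈ subgradSet g, a + b = y := by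
  obtain ⟨m, hm⟩ := hy
  have hm' : ∀ x, m ≤ f x + g x - ⟪x, y⟫ := fun x => hm ⟨x, rfl⟩
  have hlin : ConcaveOn ℝ Set.univ fun x : EuclideanSpace ℝ (Fin n) => ⟪x, y⟫ + m :=
    ⟨convex_univ, fun p _ q _ s t _ _ hst => by
      simp only [inner_add_left, real_inner_smul_left, smul_eq_mul]
      linear_combination m * hst⟩
  obtain ⟨a, c, hac⟩ := hf.exists_affine_between (hlin.sub hg) (fun x => by
    simp only [Pi.sub_apply]; linarith [hm' x])
  refine ⟨a, ⟨c, ?_⟩, y - a, ⟨m - c, ?_⟩, by abel⟩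
  · rintro _ ⟨x, rfl⟩
    linarith [(hac x).2]
  · rintro _ ⟨x, rfl⟩
    have := (hac x).1
    simp only [Pi.sub_apply] at this
    simp only [inner_sub_right]
    linarith

theorem smul_mem_subgradSet_of_mul {n : ℕ} {f : EuclideanSpace ℝ (Fin n) → ℝ} {s : ℝ}
    (hs : 0 < s) {y : EuclideanSpace ℝ (Fin n)} (hy : y ∈ subgradSet (fun x => s * f x)) :
    s⁻¹ • y ∈ subgradSet f := by
  obtain ⟨m, hm⟩ := hy
  refine ⟨s⁻¹ * m, ?_⟩
  rintro _ ⟨x, rfl⟩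
  have h := mul_le_mul_of_nonneg_left (hm ⟨x, rfl⟩) (inv_nonneg.2 hs.le)
  have h2 : s⁻¹ * (s * f x - ⟪x, y⟫) = f x - s⁻¹ * ⟪x, y⟫ := by
    field_simp
  simpa only [real_inner_smul_right, ← h2] using h

theorem subgradSet_affine {n : ℕ} (a : EuclideanSpace ℝ (Fin n)) (c : ℝ) :
    subgradSet (fun x => ⟪x, a⟫ + c) ⊆ {a} := by
  rintro y ⟨m, hm⟩
  have hm' : ∀ t : ℝ, m ≤ t * ⟪a - y, a - y⟫ + c := fun t => by
    have := hm ⟨t • (a - y), rfl⟩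
    simp only [real_inner_smul_left] at this
    rw [inner_sub_right (a - y) a y]
    linarith
  by_contra hne
  have hpos : 0 < ⟪a - y, a - y⟫ :=
    real_inner_self_pos.2 (sub_ne_zero.2 fun h => hne h.symm)
  have := hm' ((m - c - 1) / ⟪a - y, a - y⟫)
  rw [div_mul_cancel₀ _ hpos.ne'] at this
  linarith

theorem envlp_competitors_nonempty {n : ℕ} {φ : EuclideanSpace ℝ (Fin n) → ℝ}
    {A : Set (EuclideanSpace ℝ (Fin n))} {a : EuclideanSpace ℝ (Fin n)} (haA : a ∈ A)
    (ha : a ∈ subgradSet φ) (x : EuclideanSpace ℝ (Fin n)) :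
    {v : ℝ | ∃ ψ : EuclideanSpace ℝ (Fin n) → ℝ,
      ConvexOn ℝ Set.univ ψ ∧ (∀ z, ψ z ≤ φ z) ∧ subgradSet ψ ⊆ A ∧ v = ψ x}.Nonempty := by
  obtain ⟨m, hm⟩ := ha
  refine ⟨_, fun x => ⟪x, a⟫ + m, ⟨convex_univ, fun p _ q _ s t _ _ hst => ?_⟩, fun z => ?_,
    (subgradSet_affine a m).trans (Set.singleton_subset_iff.2 haA), rfl⟩
  · simp only [inner_add_left, real_inner_smul_left, smul_eq_mul]
    linear_combination -m * hst
  · have := hm ⟨z, rfl⟩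
    simp only at this
    linarith

theorem le_envlp {n : ℕ} {φ ψ : EuclideanSpace ℝ (Fin n) → ℝ}
    {A : Set (EuclideanSpace ℝ (Fin n))} (hψ : ConvexOn ℝ Set.univ ψ) (hle : ∀ z, ψ z ≤ φ z)
    (hA : subgradSet ψ ⊆ A) (x : EuclideanSpace ℝ (Fin n)) : ψ x ≤ envlp φ A x :=
  le_csSup ⟨φ x, by rintro _ ⟨ψ', _, h, _, rfl⟩; exact h x⟩ ⟨ψ, hψ, hle, hA, rfl⟩

/-- with φ smooth strictly convex whose gradient is a diffeomorphism onto the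
open convex set Δ_φ of subgradients, and u bounded continuous concave on Δ_φ, the curve
λ ↦ φ_λ := envlp φ {u ≥ λ} is concave in λ. -/
theorem envelope_concave_in_lambda {n : ℕ}
    (φ : EuclideanSpace ℝ (Fin n) → ℝ)
    (hφ : ContDiff ℝ (⊤ : ℕ∞) φ) (hφconv : StrictConvexOn ℝ Set.univ φ)
    (hΔopen : IsOpen (subgradSet φ)) (hΔconv : Convex ℝ (subgradSet φ))
    -- the gradient of φ is a diffeomorphism from ℝⁿ onto Δ_φ:
    (g : EuclideanSpace ℝ (Fin n) → EuclideanSpace ℝ (Fin n))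
    (hbij : Set.BijOn (gradient φ) Set.univ (subgradSet φ))
    (hg : ContDiffOn ℝ (⊤ : ℕ∞) g (subgradSet φ))
    (hgleft : ∀ x, g (gradient φ x) = x)
    (hgright : ∀ y ∈ subgradSet φ, gradient φ (g y) = y)
    -- u is a bounded continuous concave function on Δ_φ:
    (u : EuclideanSpace ℝ (Fin n) → ℝ)
    (hubdd : BddAbove (u '' subgradSet φ) ∧ BddBelow (u '' subgradSet φ))
    (hucont : ContinuousOn u (subgradSet φ))
    (huconc : ConcaveOn ℝ (subgradSet φ) u)
    (lam₁ lam₂ : ℝ)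
    (h₁ : {y ∈ subgradSet φ | lam₁ ≤ u y}.Nonempty)
    (h₂ : {y ∈ subgradSet φ | lam₂ ≤ u y}.Nonempty)
    (s : ℝ) (hs : s ∈ Set.Icc (0:ℝ) 1) (x : EuclideanSpace ℝ (Fin n)) :
    s * envlp φ {y ∈ subgradSet φ | lam₁ ≤ u y} x
      + (1 - s) * envlp φ {y ∈ subgradSet φ | lam₂ ≤ u y} x
      ≤ envlp φ {y ∈ subgradSet φ | s * lam₁ + (1 - s) * lam₂ ≤ u y} x := by
  obtain ⟨hs0, hs1⟩ := hs
  rcases hs0.eq_or_lt with rfl | hs0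
  · simp
  rcases hs1.eq_or_lt with rfl | hs1
  · simp
  have ht0 : 0 < 1 - s := sub_pos.2 hs1
  obtain ⟨a₁, ha₁⟩ := h₁
  obtain ⟨a₂, ha₂⟩ := h₂
  have key : ∀ ψ₁ ψ₂ : EuclideanSpace ℝ (Fin n) → ℝ,
      ConvexOn ℝ Set.univ ψ₁ → (∀ z, ψ₁ z ≤ φ z) →
      subgradSet ψ₁ ⊆ {y ∈ subgradSet φ | lam₁ ≤ u y} →
      ConvexOn ℝ Set.univ ψ₂ → (∀ z, ψ₂ z ≤ φ z) →
      subgradSet ψ₂ ⊆ {y ∈ subgradSet φ | lam₂ ≤ u y} →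
      s * ψ₁ x + (1 - s) * ψ₂ x
        ≤ envlp φ {y ∈ subgradSet φ | s * lam₁ + (1 - s) * lam₂ ≤ u y} x := by
    intro ψ₁ ψ₂ hc₁ hle₁ hA₁ hc₂ hle₂ hA₂
    have hsc₁ : ConvexOn ℝ Set.univ fun z => s * ψ₁ z := hc₁.smul hs0.le
    have hsc₂ : ConvexOn ℝ Set.univ fun z => (1 - s) * ψ₂ z := hc₂.smul ht0.le
    refine le_envlp (ψ := fun z => s * ψ₁ z + (1 - s) * ψ₂ z) (hsc₁.add hsc₂) (fun z => ?_) ?_ x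
    · nlinarith [hle₁ z, hle₂ z]
    · intro y hy
      obtain ⟨a, ha, b, hb, rfl⟩ := exists_add_eq_of_mem_subgradSet_add hsc₁ hsc₂ hy
      obtain ⟨ha, hua⟩ := hA₁ (smul_mem_subgradSet_of_mul hs0 ha)
      obtain ⟨hb, hub⟩ := hA₂ (smul_mem_subgradSet_of_mul ht0 hb)
      have hadd : s + (1 - s) = 1 := add_sub_cancel _ _
      have hmem := hΔconv ha hb hs0.le ht0.le hadd
      have hu := huconc.2 ha hb hs0.le ht0.le hadd
      rw [smul_inv_smul₀ hs0.ne', smul_inv_smul₀ ht0.ne'] at hmem hu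
      simp only [smul_eq_mul] at hu
      exact ⟨hmem, by nlinarith⟩
  have hne₁ := envlp_competitors_nonempty ha₁ ha₁.1 x
  have hne₂ := envlp_competitors_nonempty ha₂ ha₂.1 x
  rw [← le_sub_iff_add_le, ← le_div_iff₀' hs0]
  refine csSup_le hne₁ ?_
  rintro _ ⟨ψ₁, hc₁, hle₁, hA₁, rfl⟩
  rw [le_div_iff₀' hs0, le_sub_iff_add_le, ← le_sub_iff_add_le', ← le_div_iff₀' ht0]
  refine csSup_le hne₂ ?_
  rintro _ ⟨ψ₂, hc₂, hle₂, hA₂, rfl⟩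
  rw [le_div_iff₀' ht0, le_sub_iff_add_le']
  exact key ψ₁ ψ₂ hc₁ hle₁ hA₁ hc₂ hle₂ hA₂
end

section
/- Let φ : ℝⁿ → ℝ be a smooth strictly convex function whose gradient map ∇φ is a diffeomorphism from ℝⁿ onto the open convex set Δ_φ of subgradients of φ, and let u : Δ_φ → ℝ be a bounded continuous concave function. For λ ∈ ℝ set A_λ := {y ∈ Δ_φ : u(y) ≥ λ} and φ_λ(x) := sup{ψ(x) : ψ : ℝⁿ → ℝ convex, ψ ≤ φ on ℝⁿ, and Δ_ψ ⊆ A_λ}. Then for every λ with A_λ nonempty, the contact set satisfies {x ∈ ℝⁿ : φ_λ(x) = φ(x)} = {x ∈ ℝⁿ : u(∇φ(x)) ≥ λ}. -/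
open scoped RealInnerProductSpace

/-- A convex function on a finite-dimensional space has, below any value `a < ψ x`, an affine
minorant taking the value `a` at `x`. -/
theorem exists_inner_add_le_of_lt {E : Type*} [NormedAddCommGroup E] [InnerProductSpace ℝ E]
    [FiniteDimensional ℝ E] {ψ : E → ℝ} (hψ : ConvexOn ℝ Set.univ ψ) {x : E} {a : ℝ}
    (ha : a < ψ x) : ∃ y : E, ∀ z, a + ⟪z - x, y⟫ ≤ ψ z := by
  have hcont : Continuous ψ := hψ.locallyLipschitz.continuous
  obtain ⟨l, c, hle, hx⟩ := ConvexOn.exists_affine_le_of_lt (𝕜 := ℝ) (Set.mem_univ x) ha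
    isClosed_univ (hcont.lowerSemicontinuous.lowerSemicontinuousOn _) hψ
  refine ⟨(InnerProductSpace.toDual ℝ E).symm l, fun z => ?_⟩
  have hz : l z + c ≤ ψ z := hle ⟨z, Set.mem_univ z⟩
  have hx' : l x + c = a := hx
  rw [real_inner_comm, InnerProductSpace.toDual_symm_apply, map_sub]
  linarith

/-- The gradient inequality for convex functions. -/
theorem ConvexOn.add_inner_le_of_hasGradientAt {E : Type*} [NormedAddCommGroup E]
    [InnerProductSpace ℝ E] [CompleteSpace E] {φ : E → ℝ} (hφ : ConvexOn ℝ Set.univ φ) {x y : E}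
    (hy : HasGradientAt φ y x) (z : E) : φ x + ⟪z - x, y⟫ ≤ φ z := by
  have hline : HasDerivAt (fun t : ℝ => AffineMap.lineMap x z t) (z - x) 0 :=
    AffineMap.hasDerivAt_lineMap
  have hderiv : HasDerivAt (φ ∘ AffineMap.lineMap (k := ℝ) x z) ⟪y, z - x⟫ 0 := by
    have hfd := hy.hasFDerivAt
    rw [← AffineMap.lineMap_apply_zero (k := ℝ) x z] at hfd
    simpa using hfd.comp_hasDerivAt (0 : ℝ) hline
  have hconv : ConvexOn ℝ Set.univ (φ ∘ AffineMap.lineMap (k := ℝ) x z) :=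
    hφ.comp_affineMap (AffineMap.lineMap x z)
  have h := hconv.le_slope_of_hasDerivAt (Set.mem_univ 0) (Set.mem_univ 1) one_pos hderiv
  simp only [slope_def_field, Function.comp_apply, AffineMap.lineMap_apply_one,
    AffineMap.lineMap_apply_zero, sub_zero, div_one] at h
  rw [real_inner_comm]
  linarith

/-- Slopes of affine minorants that almost touch `φ` at `x` are close to the gradient at `x`. -/
theorem HasGradientAt.exists_forall_norm_sub_lt {E : Type*} [NormedAddCommGroup E]
    [InnerProductSpace ℝ E] [CompleteSpace E] {φ : E → ℝ} {x y₀ : E}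
    (h : HasGradientAt φ y₀ x) {δ : ℝ} (hδ : 0 < δ) :
    ∃ ε > 0, ∀ y, (∀ z, φ x - ε + ⟪z - x, y⟫ ≤ φ z) → ‖y - y₀‖ < δ := by
  have hlo := (hasGradientAt_iff_isLittleO_nhds_zero.mp h).def (half_pos hδ)
  obtain ⟨t, ht, hball⟩ := Metric.nhds_basis_closedBall.eventually_iff.mp hlo
  refine ⟨t * δ / 4, by positivity, fun y hy => ?_⟩
  by_contra! hfar
  have hpos : 0 < ‖y - y₀‖ := hδ.trans_le hfar
  set v : E := (t / ‖y - y₀‖) • (y - y₀) with hv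
  have hnorm : ‖v‖ = t := by
    rw [hv, norm_smul, Real.norm_of_nonneg (by positivity)]
    field_simp
  have hinner : ⟪v, y - y₀⟫ = t * ‖y - y₀‖ := by
    rw [hv, real_inner_smul_left, real_inner_self_eq_norm_sq]
    field_simp
  have h₁ := le_of_abs_le (hball (show v ∈ Metric.closedBall 0 t by simp [hnorm]))
  have h₂ := hy (x + v)
  rw [add_sub_cancel_left] at h₂
  rw [inner_sub_right] at hinner
  rw [hnorm, real_inner_comm] at h₁
  nlinarith [mul_le_mul_of_nonneg_left hfar ht.le, mul_pos ht hδ]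

theorem mem_subgradSet_of_add_inner_le {n : ℕ} {ψ : EuclideanSpace ℝ (Fin n) → ℝ} {a : ℝ}
    {x y : EuclideanSpace ℝ (Fin n)} (h : ∀ z, a + ⟪z - x, y⟫ ≤ ψ z) : y ∈ subgradSet ψ := by
  refine ⟨a - ⟪x, y⟫, ?_⟩
  rintro _ ⟨z, rfl⟩
  have hz := h z
  rw [inner_sub_left] at hz
  dsimp only
  linarith

theorem subgradSet_const_add_inner_subset {n : ℕ} (a : ℝ) (x y : EuclideanSpace ℝ (Fin n)) :
    subgradSet (fun z => a + ⟪z - x, y⟫) ⊆ {y} := by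
  rintro w ⟨m, hm⟩
  by_contra hne
  have hpos : 0 < ‖w - y‖ ^ 2 := by
    have := sub_ne_zero.mpr hne
    positivity
  set s : ℝ := (a - ⟪x, y⟫ - m + 1) / ‖w - y‖ ^ 2 with hs
  have hbound := hm ⟨s • (w - y), rfl⟩
  have hself : s * ⟪w - y, w - y⟫ = a - ⟪x, y⟫ - m + 1 := by
    rw [real_inner_self_eq_norm_sq, hs, div_mul_cancel₀ _ hpos.ne']
  rw [inner_sub_right] at hself
  simp only [inner_sub_left, real_inner_smul_left] at hbound hself
  linarith

theorem convexOn_const_add_inner {E : Type*} [NormedAddCommGroup E] [InnerProductSpace ℝ E]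
    (a : ℝ) (x y : E) : ConvexOn ℝ Set.univ (fun z : E => a + ⟪z - x, y⟫) := by
  refine ⟨convex_univ, fun p _ q _ b c _ _ hbc => le_of_eq ?_⟩
  simp only [inner_sub_left, inner_add_left, real_inner_smul_left, smul_eq_mul]
  linear_combination (⟪x, y⟫ - a) * hbc

/-- with φ smooth strictly convex whose gradient is a diffeomorphism onto the
open convex set Δ_φ of subgradients, and u bounded continuous concave on Δ_φ, the contact set
of the envelope φ_λ equals `{x : u(∇φ(x)) ≥ λ}`, whenever A_λ is nonempty. -/
theorem envelope_contact_set {n : ℕ}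
    (φ : EuclideanSpace ℝ (Fin n) → ℝ)
    (hφ : ContDiff ℝ (⊤ : ℕ∞) φ) (hφconv : StrictConvexOn ℝ Set.univ φ)
    (hΔopen : IsOpen (subgradSet φ)) (hΔconv : Convex ℝ (subgradSet φ))
    -- the gradient of φ is a diffeomorphism from ℝⁿ onto Δ_φ:
    (g : EuclideanSpace ℝ (Fin n) → EuclideanSpace ℝ (Fin n))
    (hbij : Set.BijOn (gradient φ) Set.univ (subgradSet φ))
    (hg : ContDiffOn ℝ (⊤ : ℕ∞) g (subgradSet φ))
    (hgleft : ∀ x, g (gradient φ x) = x)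
    (hgright : ∀ y ∈ subgradSet φ, gradient φ (g y) = y)
    -- u is a bounded continuous concave function on Δ_φ:
    (u : EuclideanSpace ℝ (Fin n) → ℝ)
    (hubdd : BddAbove (u '' subgradSet φ) ∧ BddBelow (u '' subgradSet φ))
    (hucont : ContinuousOn u (subgradSet φ))
    (huconc : ConcaveOn ℝ (subgradSet φ) u)
    (lam : ℝ)
    (hne : {y ∈ subgradSet φ | lam ≤ u y}.Nonempty) :
    {x : EuclideanSpace ℝ (Fin n) | envlp φ {y ∈ subgradSet φ | lam ≤ u y} x = φ x}
      = {x : EuclideanSpace ℝ (Fin n) | lam ≤ u (gradient φ x)} := by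
  have hgrad : ∀ x, HasGradientAt φ (gradient φ x) x := fun x =>
    (hφ.differentiable (by simp) x).hasGradientAt
  have htangent : ∀ x z, φ x + ⟪z - x, gradient φ x⟫ ≤ φ z := fun x z =>
    hφconv.convexOn.add_inner_le_of_hasGradientAt (hgrad x) z
  have hmaps : ∀ x, gradient φ x ∈ subgradSet φ := fun x => hbij.mapsTo (Set.mem_univ x)
  ext x
  simp only [Set.mem_ofPred_eq]
  constructor
  · intro hcontact
    by_contra! hlt
    obtain ⟨δ, hδ, hball⟩ := Metric.mem_nhdsWithin_iff.mp
      ((hucont _ (hmaps x)).eventually (Iio_mem_nhds hlt))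
    obtain ⟨ε, hε, hclose⟩ := (hgrad x).exists_forall_norm_sub_lt hδ
    obtain ⟨y, hyΔ, hyu⟩ := hne
    have hbelow : ∀ z, φ (g y) + ⟪z - g y, y⟫ ≤ φ z := fun z => by
      simpa only [hgright y hyΔ] using htangent (g y) z
    have hnonempty : {v : ℝ | ∃ ψ : EuclideanSpace ℝ (Fin n) → ℝ, ConvexOn ℝ Set.univ ψ ∧
        (∀ z, ψ z ≤ φ z) ∧ subgradSet ψ ⊆ {y ∈ subgradSet φ | lam ≤ u y} ∧ v = ψ x}.Nonempty :=
      ⟨_, _, convexOn_const_add_inner _ _ _, hbelow,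
        (subgradSet_const_add_inner_subset _ _ _).trans
          (Set.singleton_subset_iff.mpr ⟨hyΔ, hyu⟩), rfl⟩
    obtain ⟨_, ⟨ψ, hψ, hψφ, hψA, rfl⟩, hψx⟩ := exists_lt_of_lt_csSup hnonempty
      ((sub_lt_self _ hε).trans_eq hcontact.symm)
    obtain ⟨w, hw⟩ := exists_inner_add_le_of_lt hψ hψx
    obtain ⟨hwΔ, hwu⟩ := hψA (mem_subgradSet_of_add_inner_le hw)
    have hnear := hclose w fun z => (hw z).trans (hψφ z)
    exact absurd (hball ⟨mem_ball_iff_norm.mpr hnear, hwΔ⟩) (not_lt.mpr hwu)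
  · intro hx
    refine IsGreatest.csSup_eq ⟨⟨_, convexOn_const_add_inner (φ x) x (gradient φ x), htangent x,
      (subgradSet_const_add_inner_subset _ _ _).trans
        (Set.singleton_subset_iff.mpr ⟨hmaps x, hx⟩), by simp⟩, ?_⟩
    rintro _ ⟨ψ, -, hψφ, -, rfl⟩
    exact hψφ x
end

section
/- Let φ : ℝⁿ → ℝ be a convex function and let A be a nonempty subset of Δ_φ, the set of subgradients of φ. Then for every x ∈ ℝⁿ: sup{ψ(x) : ψ : ℝⁿ → ℝ convex, ψ ≤ φ on ℝⁿ, and Δ_ψ ⊆ A} = sup{⟨x,y⟩ + c : y ∈ A, c ∈ ℝ, and ⟨z,y⟩ + c ≤ φ(z) for all z ∈ ℝⁿ}. That is, the envelope of convex functions below φ with subgradients contained in A equals the supremum of the affine minorants of φ whose slopes lie in A. -/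
open scoped RealInnerProductSpace

/-- A convex function on a finite-dimensional inner product space has a supporting affine
function at every point. -/
lemma ConvexOn.exists_inner_sub_add_le {E : Type*} [NormedAddCommGroup E] [InnerProductSpace ℝ E]
    [FiniteDimensional ℝ E] {ψ : E → ℝ} (hψ : ConvexOn ℝ Set.univ ψ) (x : E) :
    ∃ y : E, ∀ z, ⟪z - x, y⟫ + ψ x ≤ ψ z := by
  have hopen : IsOpen {p : E × ℝ | p.1 ∈ Set.univ ∧ ψ p.1 < p.2} := by
    simpa using isOpen_lt (hψ.locallyLipschitz.continuous.comp continuous_fst) continuous_snd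
  obtain ⟨f, hf⟩ := geometric_hahn_banach_point_open (x := (x, ψ x)) hψ.convex_strict_epigraph
    hopen (by simp)
  set a : ℝ := f (0, 1)
  set l : StrongDual ℝ E := f.comp (ContinuousLinearMap.inl ℝ E ℝ)
  have hdecomp (z : E) (t : ℝ) : f (z, t) = l z + t * a := by
    have h : ((z, t) : E × ℝ) = (z, 0) + t • (0, 1) := by simp
    rw [h, map_add, map_smul]
    rfl
  have hlt (z : E) (t : ℝ) (ht : ψ z < t) : l x + ψ x * a < l z + t * a := by
    simpa only [hdecomp] using hf (z, t) ⟨Set.mem_univ z, ht⟩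
  have ha : 0 < a := by linarith [hlt x (ψ x + 1) (by linarith)]
  refine ⟨-(a⁻¹ • (InnerProductSpace.toDual ℝ E).symm l), fun z => ?_⟩
  rw [inner_neg_right, inner_smul_right, real_inner_comm, InnerProductSpace.toDual_symm_apply,
    map_sub]
  refine le_of_forall_gt_imp_ge_of_dense fun t ht => le_of_mul_le_mul_right ?_ ha
  have hcancel : (-(a⁻¹ * (l z - l x)) + ψ x) * a = -(l z - l x) + ψ x * a := by
    field_simp
  linarith [hlt z t ht]

lemma mem_subgradSet_of_inner_add_le {n : ℕ} {ψ : EuclideanSpace ℝ (Fin n) → ℝ}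
    {y : EuclideanSpace ℝ (Fin n)} {c : ℝ} (h : ∀ z, ⟪z, y⟫ + c ≤ ψ z) : y ∈ subgradSet ψ := by
  refine ⟨c, ?_⟩
  rintro _ ⟨z, rfl⟩
  dsimp only
  linarith [h z]

lemma subgradSet_inner_add_const_subset {n : ℕ} (y : EuclideanSpace ℝ (Fin n)) (c : ℝ) :
    subgradSet (fun z => ⟪z, y⟫ + c) ⊆ {y} := by
  rintro w ⟨m, hm⟩
  by_contra hne
  have hpos : 0 < ⟪w - y, w - y⟫ := real_inner_self_pos.2 (sub_ne_zero.2 hne)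
  have h := hm ⟨((c - m + 1) / ⟪w - y, w - y⟫) • (w - y), rfl⟩
  have hsub : ⟪w - y, y⟫ - ⟪w - y, w⟫ = -⟪w - y, w - y⟫ := by
    rw [← inner_sub_right, ← neg_sub w y, inner_neg_right]
  simp only [inner_smul_left, conj_trivial] at h
  have hstep : (c - m + 1) / ⟪w - y, w - y⟫ * ⟪w - y, y⟫
      - (c - m + 1) / ⟪w - y, w - y⟫ * ⟪w - y, w⟫ = -(c - m + 1) := by
    rw [← mul_sub, hsub, mul_neg, div_mul_cancel₀ _ hpos.ne']
  linarith

/-- for φ convex and ∅ ≠ A ⊆ Δ_φ, the envelope of convex functions below φ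
with subgradients contained in A equals the supremum of the affine minorants of φ whose
slopes lie in A. -/
theorem envelope_eq_sup_affine_minorants {n : ℕ}
    (φ : EuclideanSpace ℝ (Fin n) → ℝ)
    (hφconv : ConvexOn ℝ Set.univ φ)
    (A : Set (EuclideanSpace ℝ (Fin n)))
    (hA : A.Nonempty) (hAsub : A ⊆ subgradSet φ)
    (x : EuclideanSpace ℝ (Fin n)) :
    sSup {v : ℝ | ∃ ψ : EuclideanSpace ℝ (Fin n) → ℝ,
        ConvexOn ℝ Set.univ ψ ∧ (∀ z, ψ z ≤ φ z) ∧ subgradSet ψ ⊆ A ∧ v = ψ x}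
      = sSup {v : ℝ | ∃ y ∈ A, ∃ c : ℝ,
          (∀ z, ⟪z, y⟫ + c ≤ φ z) ∧ v = ⟪x, y⟫ + c} := by
  congr 1
  ext v
  constructor
  · rintro ⟨ψ, hψ, hle, hsub, rfl⟩
    obtain ⟨y, hy⟩ := hψ.exists_inner_sub_add_le x
    have hminor (z : EuclideanSpace ℝ (Fin n)) : ⟪z, y⟫ + (ψ x - ⟪x, y⟫) ≤ ψ z := by
      have h := hy z
      rw [inner_sub_left] at h
      linarith
    exact ⟨y, hsub (mem_subgradSet_of_inner_add_le hminor), ψ x - ⟪x, y⟫,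
      fun z => (hminor z).trans (hle z), by ring⟩
  · rintro ⟨y, hy, c, hle, rfl⟩
    refine ⟨fun z => ⟪z, y⟫ + c, ?_, hle,
      (subgradSet_inner_add_const_subset y c).trans (Set.singleton_subset_iff.2 hy), rfl⟩
    refine ⟨convex_univ, fun u _ v _ s t _ _ hst => le_of_eq ?_⟩
    simp only [inner_add_left, real_inner_smul_left, smul_eq_mul]
    linear_combination (-c) * hst
end

section
/- Let C > 0, a ∈ ℝ, and let g : ℝ → ℝ ∪ {−∞} be a nonincreasing function such that g(λ) = a for all λ ≤ −C and g(λ) = −∞ for all λ > C. Then f(t) := sup_{λ∈ℝ}(g(λ) + t·λ) is a finite real number for every t ≥ 0, f(0) = a, and the right derivative of f at 0 exists and equals sup{λ ∈ ℝ : g(λ) = a}. -/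
/-- The set of real values `g(λ) + t·λ` over those `λ` where `g(λ)` is finite. -/
def legSet (g : ℝ → WithBot ℝ) (t : ℝ) : Set ℝ :=
  {v : ℝ | ∃ lam b : ℝ, g lam = (b : WithBot ℝ) ∧ v = b + t * lam}

/-- The Legendre transform `f(t) := sup_λ (g(λ) + t·λ)` of `g : ℝ → ℝ ∪ {−∞}`, as a
supremum of a set of real numbers (the values at λ with g(λ) = −∞ contribute nothing). -/
noncomputable def legTrans (g : ℝ → WithBot ℝ) (t : ℝ) : ℝ :=
  sSup (legSet g t)

/-- Away from the level set `{g = a}`, the finite values of `g` stay below `a` by a fixed gap. -/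
lemma exists_lt_forall_le_of_antitone {g : ℝ → WithBot ℝ} {a l₀ : ℝ}
    (hmono : ∀ ⦃l₁ l₂ : ℝ⦄, l₁ ≤ l₂ → g l₂ ≤ g l₁) (h : g l₀ < (a : WithBot ℝ)) :
    ∃ d < a, ∀ l b : ℝ, l₀ ≤ l → g l = (b : WithBot ℝ) → b ≤ d := by
  cases h₀ : g l₀ with
  | bot =>
    refine ⟨a - 1, by linarith, fun l b hl hb => ?_⟩
    have h₁ := hmono hl
    rw [hb, h₀] at h₁
    simp at h₁
  | coe d =>
    rw [h₀] at h
    refine ⟨d, WithBot.coe_lt_coe.mp h, fun l b hl hb => ?_⟩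
    have h₁ := hmono hl
    rw [hb, h₀] at h₁
    exact WithBot.coe_le_coe.mp h₁

/-- let g : ℝ → ℝ ∪ {−∞} be nonincreasing with g ≡ a on (−∞,−C] and
g ≡ −∞ on (C,∞). Then f(t) := sup_λ (g(λ) + t·λ) is finite for every t ≥ 0, f(0) = a, and
the right derivative of f at 0 exists and equals sup{λ : g(λ) = a}. -/
theorem legendre_right_derivative_at_zero (C : ℝ) (hC : 0 < C) (a : ℝ)
    (g : ℝ → WithBot ℝ)
    (hmono : ∀ ⦃l₁ l₂ : ℝ⦄, l₁ ≤ l₂ → g l₂ ≤ g l₁)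
    (hlow : ∀ l : ℝ, l ≤ -C → g l = (a : WithBot ℝ))
    (hhigh : ∀ l : ℝ, C < l → g l = (⊥ : WithBot ℝ)) :
    (∀ t : ℝ, 0 ≤ t → (legSet g t).Nonempty ∧ BddAbove (legSet g t)) ∧
    legTrans g 0 = a ∧
    HasDerivWithinAt (legTrans g) (sSup {l : ℝ | g l = (a : WithBot ℝ)}) (Set.Ici 0) 0 := by
  have hle_a : ∀ l : ℝ, g l ≤ (a : WithBot ℝ) := fun l =>
    (hmono (min_le_left l (-C))).trans_eq (hlow _ (min_le_right _ _))
  have hb_le : ∀ l b : ℝ, g l = (b : WithBot ℝ) → b ≤ a := fun l b hb =>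
    WithBot.coe_le_coe.mp (hb ▸ hle_a l)
  have hle_C : ∀ l b : ℝ, g l = (b : WithBot ℝ) → l ≤ C := by
    intro l b hb
    by_contra! hl
    rw [hhigh l hl] at hb
    exact WithBot.bot_ne_coe hb
  have hne : ∀ t : ℝ, (legSet g t).Nonempty := fun t => ⟨_, -C, a, hlow _ le_rfl, rfl⟩
  have hbdd : ∀ t : ℝ, 0 ≤ t → BddAbove (legSet g t) := by
    rintro t ht
    refine ⟨a + t * C, ?_⟩
    rintro _ ⟨l, b, hb, rfl⟩
    exact add_le_add (hb_le l b hb) (mul_le_mul_of_nonneg_left (hle_C l b hb) ht)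
  have hzero : legTrans g 0 = a := by
    refine le_antisymm (csSup_le (hne 0) ?_)
      (le_csSup (hbdd 0 le_rfl) ⟨-C, a, hlow _ le_rfl, by simp⟩)
    rintro _ ⟨l, b, hb, rfl⟩
    simpa using hb_le l b hb
  refine ⟨fun t ht => ⟨hne t, hbdd t ht⟩, hzero, ?_⟩
  set S : Set ℝ := {l : ℝ | g l = (a : WithBot ℝ)}
  have hSne : S.Nonempty := ⟨-C, hlow _ le_rfl⟩
  have hSbdd : BddAbove S := ⟨C, fun l hl => hle_C l a hl⟩
  have hsC : sSup S ≤ C := csSup_le hSne fun l hl => hle_C l a hl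
  have hlower : ∀ t : ℝ, 0 ≤ t → a + t * sSup S ≤ legTrans g t := by
    intro t ht
    rcases ht.eq_or_lt with rfl | ht'
    · simp [hzero]
    have h : sSup S ≤ (legTrans g t - a) / t := by
      refine csSup_le hSne fun l hl => ?_
      rw [le_div_iff₀ ht']
      have : a + t * l ≤ legTrans g t := le_csSup (hbdd t ht) ⟨l, a, hl, rfl⟩
      linarith
    rw [le_div_iff₀ ht'] at h
    linarith
  rw [hasDerivWithinAt_iff_isLittleO, Asymptotics.isLittleO_iff]
  intro ε hε
  have hlt : g (sSup S + ε) < (a : WithBot ℝ) := by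
    refine lt_of_le_of_ne (hle_a _) fun h => ?_
    have : sSup S + ε ≤ sSup S := le_csSup hSbdd h
    linarith
  obtain ⟨d, hda, hd⟩ := exists_lt_forall_le_of_antitone hmono hlt
  have hδ : 0 < (a - d) / (C - sSup S + 1) := div_pos (by linarith) (by linarith)
  filter_upwards [self_mem_nhdsWithin, mem_nhdsWithin_of_mem_nhds (Iio_mem_nhds hδ)]
    with t ht htδ
  have ht : 0 ≤ t := ht
  have htδ : t * (C - sSup S + 1) < a - d := (lt_div_iff₀ (by linarith)).mp htδ
  have hupper : legTrans g t ≤ a + t * (sSup S + ε) := by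
    refine csSup_le (hne t) ?_
    rintro _ ⟨l, b, hb, rfl⟩
    rcases le_total (sSup S + ε) l with hl | hl
    · have h₁ := hd l b hl hb
      have h₂ := mul_le_mul_of_nonneg_left (hle_C l b hb) ht
      have h₃ := mul_nonneg ht hε.le
      linarith
    · exact add_le_add (hb_le l b hb) (mul_le_mul_of_nonneg_left hl ht)
  have h := hlower t ht
  rw [hzero, sub_zero, smul_eq_mul, Real.norm_of_nonneg (by linarith), Real.norm_of_nonneg ht]
  linarith
end
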